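/- arXiv:2107.08536 — 5 statements merged into one kernel-verified Lean document; each statement's English description precedes it below -/
import Mathlib

section
/- There exists a divisible design Cayley graph with parameters (12, 5, 0, 2, 6, 2); that is, a simple graph on 12 vertices that is simultaneously a divisible design graph with parameters (12, 5, 0, 2, 6, 2) and a Cayley graph. -/
/-- A divisible design graph (DDG) with parameters `(v, k, l1, l2, m, n)`:
a `k`-regular simple graph on `v = m * n` vertices whose vertex set can be partitioned
into `m` classes of size `n` such that two distinct vertices from the same class have
exactly `l1` common neighbours and two vertices from different classes have exactly `l2`
common neighbours. -/
def IsDDG {V : Type*} (Γ : SimpleGraph V) (v k l1 l2 m n : ℕ) : Prop :=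
  Nat.card V = v ∧ v = m * n ∧
  (∀ x : V, Nat.card {z : V // Γ.Adj x z} = k) ∧
  ∃ c : V → Fin m,
    (∀ i : Fin m, Nat.card {x : V // c x = i} = n) ∧
    (∀ x y : V, x ≠ y → c x = c y →
      Nat.card {z : V // Γ.Adj x z ∧ Γ.Adj y z} = l1) ∧
    (∀ x y : V, c x ≠ c y →
      Nat.card {z : V // Γ.Adj x z ∧ Γ.Adj y z} = l2)

/-- A simple graph is a Cayley graph if and only if its automorphism group contains a
subgroup acting regularly (sharply transitively) on the vertices. -/
def IsCayleyGraph {V : Type*} (Γ : SimpleGraph V) : Prop :=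
  ∃ H : Subgroup (Equiv.Perm V),
    (∀ g ∈ H, ∀ x y : V, Γ.Adj (g x) (g y) ↔ Γ.Adj x y) ∧
    ∀ x y : V, ∃! g : Equiv.Perm V, g ∈ H ∧ g x = y

/-- The simple graph underlying the Cayley graph of `G` with respect to `S`: the vertices `x` and
`y` are adjacent when `x⁻¹ * y ∈ S`. -/
def cayleyGraph {G : Type*} [Group G] (S : Set G) (one_notMem : 1 ∉ S)
    (inv_mem : ∀ s ∈ S, s⁻¹ ∈ S) : SimpleGraph G where
  Adj x y := x⁻¹ * y ∈ S
  symm := ⟨fun x y h => by simpa using inv_mem _ h⟩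
  loopless := ⟨fun x h => one_notMem (by simpa using h)⟩

/-- Left translations form a regular group of automorphisms of a Cayley graph. -/
theorem isCayleyGraph_cayleyGraph {G : Type*} [Group G] (S : Set G) (one_notMem : 1 ∉ S)
    (inv_mem : ∀ s ∈ S, s⁻¹ ∈ S) : IsCayleyGraph (cayleyGraph S one_notMem inv_mem) := by
  refine ⟨(MulAction.toPermHom G G).range, ?_, fun x y => ⟨MulAction.toPerm (y * x⁻¹), ?_, ?_⟩⟩
  · rintro _ ⟨a, rfl⟩ x y
    simp [cayleyGraph, mul_assoc]
  · exact ⟨⟨y * x⁻¹, rfl⟩, by simp⟩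
  · rintro _ ⟨⟨a, rfl⟩, h⟩
    obtain rfl : a * x = y := by simpa using h
    simp

namespace Icosahedron

/-- A connection set in the alternating group of degree 4 whose Cayley graph is the icosahedron:
an involution and two 3-cycles together with their inverses. -/
def connectionSet : Finset (alternatingGroup (Fin 4)) :=
  Finset.univ.filter fun g => (g : Equiv.Perm (Fin 4)) ∈
    ({c[0, 2] * c[1, 3], c[1, 2, 3], c[1, 3, 2], c[0, 2, 3], c[0, 3, 2]} :
      Finset (Equiv.Perm (Fin 4)))

/-- The icosahedron, as a Cayley graph of the alternating group of degree 4. -/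
def graph : SimpleGraph (alternatingGroup (Fin 4)) :=
  cayleyGraph connectionSet (by decide +kernel) (by decide +kernel)

instance : DecidableRel graph.Adj := fun x y =>
  inferInstanceAs (Decidable (x⁻¹ * y ∈ connectionSet))

/-- The index of the image of `{0, 1}` in the colexicographic order on the six 2-subsets of
`Fin 4`; its fibres are the pairs of antipodal vertices. -/
def antipodalClass (g : alternatingGroup (Fin 4)) : Fin 6 :=
  let a : Fin 4 := (g : Equiv.Perm (Fin 4)) 0
  let b : Fin 4 := (g : Equiv.Perm (Fin 4)) 1
  Fin.ofNat 6 ((max a b : Fin 4).val.choose 2 + (min a b : Fin 4).val)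

theorem isDDG_graph : IsDDG graph 12 5 0 2 6 2 := by
  refine ⟨?_, rfl, ?_, antipodalClass, ?_, ?_, ?_⟩ <;>
    simp only [Nat.card_eq_fintype_card] <;> decide +kernel

end Icosahedron

/-- There exists a divisible design Cayley graph with parameters
`(12, 5, 0, 2, 6, 2)`. -/
theorem exists_ddcg_12_5_0_2_6_2 :
    ∃ (V : Type) (Γ : SimpleGraph V),
        IsDDG Γ 12 5 0 2 6 2 ∧ IsCayleyGraph Γ := by
  exact ⟨_, Icosahedron.graph, Icosahedron.isDDG_graph, isCayleyGraph_cayleyGraph _ _ _⟩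
end

section
/- There exists a divisible design Cayley graph with parameters (12, 5, 1, 2, 4, 3); that is, a simple graph on 12 vertices that is simultaneously a divisible design graph with parameters (12, 5, 1, 2, 4, 3) and a Cayley graph. -/
/-- The `4 × 3` rook's graph, whose columns are the classes, is a divisible design graph. -/
theorem isDDG_boxProd_top_top :
    IsDDG ((⊤ : SimpleGraph (Fin 4)) □ (⊤ : SimpleGraph (Fin 3))) 12 5 1 2 4 3 := by
  refine ⟨by simp, rfl, ?_, Prod.fst, ?_, ?_, ?_⟩ <;>
    simp only [Nat.card_eq_fintype_card, SimpleGraph.boxProd_adj, SimpleGraph.top_adj] <;>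
    decide +kernel

/-- A graph on an additive group that is invariant under left translations is a Cayley graph. -/
theorem isCayleyGraph_of_adj_add_left {A : Type*} [AddGroup A] (Γ : SimpleGraph A)
    (h : ∀ a x y : A, Γ.Adj (a + x) (a + y) ↔ Γ.Adj x y) : IsCayleyGraph Γ := by
  refine ⟨(MulAction.toPermHom (Multiplicative A) A).range, ?_, fun x y ↦ ?_⟩
  · rintro _ ⟨a, rfl⟩ x y
    exact h a.toAdd x y
  · refine ⟨MulAction.toPermHom (Multiplicative A) A (.ofAdd (y - x)),
      ⟨⟨_, rfl⟩, sub_add_cancel y x⟩, ?_⟩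
    rintro _ ⟨⟨a, rfl⟩, hxy⟩
    have ha : a.toAdd + x = y := hxy
    rw [← ha, add_sub_cancel_right, ofAdd_toAdd]

/-- There exists a divisible design Cayley graph with parameters
`(12, 5, 1, 2, 4, 3)`. -/
theorem exists_ddcg_12_5_1_2_4_3 :
    ∃ (V : Type) (Γ : SimpleGraph V),
        IsDDG Γ 12 5 1 2 4 3 ∧ IsCayleyGraph Γ :=
  ⟨Fin 4 × Fin 3, _, isDDG_boxProd_top_top, isCayleyGraph_of_adj_add_left _ fun a x y ↦ by
    simp [SimpleGraph.boxProd_adj]⟩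
end

section
/- There exists a divisible design Cayley graph with parameters (12, 6, 2, 3, 3, 4); that is, a simple graph on 12 vertices that is simultaneously a divisible design graph with parameters (12, 6, 2, 3, 3, 4) and a Cayley graph. -/
namespace SimpleGraph

variable {G : Type*} [Group G]

/-- The Cayley graph `Cay(G, S)`, for an inverse-closed set `S` not containing the identity. -/
def cayley (S : Finset G) (hS : ∀ s ∈ S, s⁻¹ ∈ S) (h1 : 1 ∉ S) : SimpleGraph G where
  Adj x y := x⁻¹ * y ∈ S
  symm := ⟨fun x y h => by simpa using hS _ h⟩
  loopless := ⟨fun x h => h1 (by simpa using h)⟩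

variable {S : Finset G} {hS : ∀ s ∈ S, s⁻¹ ∈ S} {h1 : 1 ∉ S}

theorem cayley_adj {x y : G} : (cayley S hS h1).Adj x y ↔ x⁻¹ * y ∈ S := Iff.rfl

theorem isCayleyGraph_cayley : IsCayleyGraph (cayley S hS h1) := by
  refine ⟨(MulAction.toPermHom G G).range, ?_, fun x y => ?_⟩
  · rintro _ ⟨g, rfl⟩ x y
    simp [cayley_adj, mul_assoc]
  · refine ⟨MulAction.toPermHom G G (y * x⁻¹), ⟨⟨_, rfl⟩, by simp⟩, ?_⟩
    rintro _ ⟨⟨g, rfl⟩, h⟩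
    congr 1
    simpa [eq_mul_inv_iff_mul_eq] using h

theorem card_adj_cayley (x : G) : Nat.card {z : G // (cayley S hS h1).Adj x z} = S.card := by
  rw [← Nat.card_eq_finsetCard]
  exact Nat.card_congr ((Equiv.mulLeft x⁻¹).subtypeEquiv fun z => by simp [cayley_adj])

theorem card_common_adj_cayley [DecidableEq G] (x y : G) :
    Nat.card {z : G // (cayley S hS h1).Adj x z ∧ (cayley S hS h1).Adj y z} =
      {s ∈ S | (x⁻¹ * y)⁻¹ * s ∈ S}.card := by
  rw [← Nat.subtype_card (p := fun s => s ∈ S ∧ (x⁻¹ * y)⁻¹ * s ∈ S) _ (by simp)]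
  exact Nat.card_congr ((Equiv.mulLeft x⁻¹).subtypeEquiv fun z => by simp [cayley_adj, mul_assoc])

end SimpleGraph

namespace AlternatingGroupFour

open Equiv

/-- Two double transpositions, together with the four 3-cycles fixing `0` or fixing `3`. -/
def connectionSet : Finset (alternatingGroup (Fin 4)) :=
  {⟨swap 0 1 * swap 2 3, Equiv.Perm.mem_alternatingGroup.2 (by decide +kernel)⟩, ⟨swap 0 2 * swap 1 3, Equiv.Perm.mem_alternatingGroup.2 (by decide +kernel)⟩,
    ⟨swap 0 1 * swap 1 2, Equiv.Perm.mem_alternatingGroup.2 (by decide +kernel)⟩, ⟨swap 1 2 * swap 0 1, Equiv.Perm.mem_alternatingGroup.2 (by decide +kernel)⟩,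
    ⟨swap 1 2 * swap 2 3, Equiv.Perm.mem_alternatingGroup.2 (by decide +kernel)⟩, ⟨swap 2 3 * swap 1 2, Equiv.Perm.mem_alternatingGroup.2 (by decide +kernel)⟩}

/-- The index of the splitting of `Fin 4` into two pairs to which `g` maps `{{0, 1}, {2, 3}}`.
Its fibres are the cosets of the Klein four-subgroup. -/
def pairing (g : alternatingGroup (Fin 4)) : Fin 3 :=
  ![1, 0, 1, 2] (g.1 0 + g.1 1)

theorem inv_mem_connectionSet : ∀ s ∈ connectionSet, s⁻¹ ∈ connectionSet := by
  decide +kernel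

theorem one_notMem_connectionSet : 1 ∉ connectionSet := by
  decide +kernel

theorem pairing_eq_iff : ∀ x y, pairing x = pairing y ↔ pairing (x⁻¹ * y) = pairing 1 := by
  decide +kernel

theorem card_connectionSet_inter : ∀ g : alternatingGroup (Fin 4), g ≠ 1 →
    {s ∈ connectionSet | g⁻¹ * s ∈ connectionSet}.card =
      if pairing g = pairing 1 then 2 else 3 := by
  decide +kernel

end AlternatingGroupFour

open SimpleGraph AlternatingGroupFour

/-- There exists a divisible design Cayley graph with parameters
`(12, 6, 2, 3, 3, 4)`. -/
theorem exists_ddcg_12_6_2_3_3_4 :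
    ∃ (V : Type) (Γ : SimpleGraph V),
        IsDDG Γ 12 6 2 3 3 4 ∧ IsCayleyGraph Γ := by
  refine ⟨alternatingGroup (Fin 4),
    cayley connectionSet inv_mem_connectionSet one_notMem_connectionSet,
    ⟨?_, rfl, fun x => ?_, pairing, ?_, fun x y hxy h => ?_, fun x y h => ?_⟩,
    isCayleyGraph_cayley⟩
  · rw [Nat.card_eq_fintype_card]
    decide +kernel
  · rw [card_adj_cayley]
    decide +kernel
  · simp only [Nat.card_eq_fintype_card]
    decide +kernel
  · rw [card_common_adj_cayley, card_connectionSet_inter _ (by rwa [Ne, inv_mul_eq_one]),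
      if_pos ((pairing_eq_iff x y).1 h)]
  · have hxy : x ≠ y := fun e => h (congrArg pairing e)
    rw [card_common_adj_cayley, card_connectionSet_inter _ (by rwa [Ne, inv_mul_eq_one]),
      if_neg (mt (pairing_eq_iff x y).2 h)]
end

section
/- There exists a divisible design Cayley graph with parameters (18, 9, 6, 4, 6, 3); that is, a simple graph on 18 vertices that is simultaneously a divisible design graph with parameters (18, 9, 6, 4, 6, 3) and a Cayley graph. -/
theorem isCayleyGraph_mulCayley {G : Type*} [Group G] (S : Set G) :
    IsCayleyGraph (SimpleGraph.mulCayley S) := by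
  refine ⟨(MulAction.toPermHom G G).range, ?_, fun x y => ⟨MulAction.toPerm (y * x⁻¹), ?_, ?_⟩⟩
  · rintro _ ⟨a, rfl⟩ x y
    simp
  · exact ⟨⟨y * x⁻¹, rfl⟩, by simp⟩
  · rintro _ ⟨⟨a, rfl⟩, rfl⟩
    simp

theorem mulCayley_adj_iff_inv_mul_mem {G : Type*} [Group G] {S : Set G} (h_one : 1 ∉ S)
    (h_inv : ∀ s ∈ S, s⁻¹ ∈ S) {x y : G} :
    (SimpleGraph.mulCayley S).Adj x y ↔ x⁻¹ * y ∈ S := by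
  rw [SimpleGraph.mulCayley_adj']
  constructor
  · rintro ⟨-, g, hg, rfl | rfl⟩
    · simpa using hg
    · simpa using h_inv g hg
  · intro h
    refine ⟨?_, x⁻¹ * y, h, Or.inl (mul_inv_cancel_left x y)⟩
    rintro rfl
    exact h_one (by simpa using h)

theorem card_neighbors_mulCayley {G : Type*} [Group G] {S : Finset G} (h_one : 1 ∉ S)
    (h_inv : ∀ s ∈ S, s⁻¹ ∈ S) (x : G) :
    Nat.card {z // (SimpleGraph.mulCayley (S : Set G)).Adj x z} = S.card := by
  rw [← Nat.card_eq_finsetCard]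
  exact Nat.card_congr ((Equiv.mulLeft x⁻¹).subtypeEquiv fun z =>
    mulCayley_adj_iff_inv_mul_mem h_one h_inv)

/-- The common neighbours of `x` and `y` are counted by the `s ∈ S` with `y⁻¹ * x * s ∈ S`. -/
theorem card_common_neighbors_mulCayley {G : Type*} [Group G] [DecidableEq G] {S : Finset G}
    (h_one : 1 ∉ S) (h_inv : ∀ s ∈ S, s⁻¹ ∈ S) (x y : G) :
    Nat.card {z // (SimpleGraph.mulCayley (S : Set G)).Adj x z ∧
      (SimpleGraph.mulCayley (S : Set G)).Adj y z} =
      (S.filter fun s => y⁻¹ * x * s ∈ S).card := by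
  rw [← Nat.card_eq_finsetCard]
  refine Nat.card_congr ((Equiv.mulLeft x⁻¹).subtypeEquiv fun z => ?_)
  rw [mulCayley_adj_iff_inv_mul_mem h_one h_inv, mulCayley_adj_iff_inv_mul_mem h_one h_inv]
  simp [mul_assoc]

/-- The direct product of the symmetric group of degree `3`, viewed as a dihedral group,
and the cyclic group of order `3`. -/
abbrev DihedralProdCyclic : Type := DihedralGroup 3 × Multiplicative (ZMod 3)

namespace DihedralProdCyclic

open DihedralGroup Multiplicative

/-- The connection set of the graph. -/
def connectionSet : Finset DihedralProdCyclic :=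
  {(r 0, ofAdd 1), (r 1, ofAdd 1), (r 2, ofAdd 1), (r 0, ofAdd 2), (r 1, ofAdd 2), (r 2, ofAdd 2),
    (sr 2, ofAdd 0), (sr 1, ofAdd 1), (sr 1, ofAdd 2)}

/-- The class of an element: its coset modulo the rotations of the dihedral factor. -/
def rotationCoset : DihedralProdCyclic → Fin 6
  | (r _, a) => Fin.castLE (by decide) (show Fin 3 from a.toAdd)
  | (sr _, a) => Fin.natAdd 3 (show Fin 3 from a.toAdd)

theorem one_notMem_connectionSet : 1 ∉ connectionSet := by
  decide

theorem inv_mem_connectionSet : ∀ s ∈ connectionSet, s⁻¹ ∈ connectionSet := by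
  decide

end DihedralProdCyclic

/-- There exists a divisible design Cayley graph with parameters
`(18, 9, 6, 4, 6, 3)`. -/
theorem exists_ddcg_18_9_6_4_6_3 :
    ∃ (V : Type) (Γ : SimpleGraph V),
        IsDDG Γ 18 9 6 4 6 3 ∧ IsCayleyGraph Γ := by
  refine ⟨DihedralProdCyclic,
    SimpleGraph.mulCayley (DihedralProdCyclic.connectionSet : Set DihedralProdCyclic),
    ⟨?_, by norm_num, fun x => ?_, DihedralProdCyclic.rotationCoset, fun i => ?_,
      fun x y hxy hc => ?_, fun x y hc => ?_⟩,
    isCayleyGraph_mulCayley _⟩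
  · rw [Nat.card_eq_fintype_card]
    decide
  · rw [card_neighbors_mulCayley DihedralProdCyclic.one_notMem_connectionSet
      DihedralProdCyclic.inv_mem_connectionSet]
    decide
  · rw [Nat.card_eq_fintype_card]
    revert i
    decide
  · rw [card_common_neighbors_mulCayley DihedralProdCyclic.one_notMem_connectionSet
      DihedralProdCyclic.inv_mem_connectionSet]
    revert x y
    decide +kernel
  · rw [card_common_neighbors_mulCayley DihedralProdCyclic.one_notMem_connectionSet
      DihedralProdCyclic.inv_mem_connectionSet]
    revert x y
    decide +kernel
end

section
/- There exists a divisible design Cayley graph with parameters (27, 18, 9, 12, 9, 3); that is, a simple graph on 27 vertices that is simultaneously a divisible design graph with parameters (27, 18, 9, 12, 9, 3) and a Cayley graph. -/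
/-- The Heisenberg group over `ZMod 3`, the extraspecial group of order `27` and exponent `3`:
the triple `(a, b, c)` is the upper unitriangular matrix with rows `1 a c`, `0 1 b`, `0 0 1`. -/
def HeisenbergThree : Type := ZMod 3 × ZMod 3 × ZMod 3

namespace HeisenbergThree

instance : DecidableEq HeisenbergThree := inferInstanceAs (DecidableEq (ZMod 3 × ZMod 3 × ZMod 3))

instance : Fintype HeisenbergThree := inferInstanceAs (Fintype (ZMod 3 × ZMod 3 × ZMod 3))

instance : Mul HeisenbergThree :=
  ⟨fun x y => (x.1 + y.1, x.2.1 + y.2.1, x.2.2 + y.2.2 + x.1 * y.2.1)⟩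

instance : One HeisenbergThree := ⟨(0, 0, 0)⟩

instance : Inv HeisenbergThree := ⟨fun x => (-x.1, -x.2.1, -x.2.2 + x.1 * x.2.1)⟩

instance : Group HeisenbergThree :=
  Group.ofLeftAxioms
    (fun x y z => Prod.ext (add_assoc _ _ _) (Prod.ext (add_assoc _ _ _)
      (show x.2.2 + y.2.2 + x.1 * y.2.1 + z.2.2 + (x.1 + y.1) * z.2.1 =
        x.2.2 + (y.2.2 + z.2.2 + y.1 * z.2.1) + x.1 * (y.2.1 + z.2.1) by ring)))
    (by decide +kernel)
    (by decide +kernel)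

/-- The indicator of the connection set. -/
def Connects (x : HeisenbergThree) : Prop := x.2.2 + x.1 + x.2.1 + x.1 * x.2.1 ≠ 0

instance : DecidablePred Connects := fun x =>
  inferInstanceAs (Decidable (x.2.2 + x.1 + x.2.1 + x.1 * x.2.1 ≠ 0))

theorem connects_inv : ∀ x : HeisenbergThree, Connects x → Connects x⁻¹ := by decide +kernel

/-- The Cayley graph of the Heisenberg group with connection set `Connects`. -/
def graph : SimpleGraph HeisenbergThree where
  Adj x y := Connects (x⁻¹ * y)
  symm := ⟨fun x y h => by simpa using connects_inv _ h⟩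
  loopless := ⟨fun x h => by rw [inv_mul_cancel] at h; exact h (by decide)⟩

instance : DecidableRel graph.Adj := fun x y => inferInstanceAs (Decidable (Connects (x⁻¹ * y)))

theorem graph_adj_mul_left (g x y : HeisenbergThree) :
    graph.Adj (g * x) (g * y) ↔ graph.Adj x y := by
  simp [graph, mul_assoc]

theorem isCayleyGraph_graph : IsCayleyGraph graph := by
  refine ⟨(MulAction.toPermHom HeisenbergThree HeisenbergThree).range, ?_, fun x y => ?_⟩
  · rintro _ ⟨g, rfl⟩ x y
    exact graph_adj_mul_left g x y
  · refine ⟨MulAction.toPermHom _ _ (y * x⁻¹), ⟨⟨_, rfl⟩, by simp⟩, ?_⟩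
    rintro _ ⟨⟨g, rfl⟩, rfl⟩
    simp

/-- The index of the coset of the centre that contains a given element. -/
def centreCoset (x : HeisenbergThree) : Fin 9 := finProdFinEquiv (m := 3) (n := 3) (x.1, x.2.1)

theorem centreCoset_eq_iff (x y : HeisenbergThree) :
    centreCoset x = centreCoset y ↔ centreCoset 1 = centreCoset (x⁻¹ * y) := by
  simp only [centreCoset, EmbeddingLike.apply_eq_iff_eq, Prod.ext_iff]
  change _ ↔ (0 = -x.1 + y.1 ∧ 0 = -x.2.1 + y.2.1)
  exact and_congr (by grind) (by grind)

theorem card_neighbors (x : HeisenbergThree) : Nat.card {z // graph.Adj x z} = 18 := by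
  have h : Nat.card {z // graph.Adj 1 z} = 18 := by
    rw [Nat.card_eq_fintype_card]; decide +kernel
  rw [← h]
  exact Nat.card_congr ((Equiv.mulLeft x⁻¹).subtypeEquiv fun z => by
    simpa using (graph_adj_mul_left x⁻¹ x z).symm)

theorem card_common_neighbors_eq_one (x y : HeisenbergThree) :
    Nat.card {z // graph.Adj x z ∧ graph.Adj y z} =
      Nat.card {z // graph.Adj 1 z ∧ graph.Adj (x⁻¹ * y) z} :=
  Nat.card_congr ((Equiv.mulLeft x⁻¹).subtypeEquiv fun z => by
    simpa using and_congr (graph_adj_mul_left x⁻¹ x z).symm (graph_adj_mul_left x⁻¹ y z).symm)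

theorem card_common_neighbors_one : ∀ y : HeisenbergThree, y ≠ 1 →
    Fintype.card {z // graph.Adj 1 z ∧ graph.Adj y z} =
      if centreCoset 1 = centreCoset y then 9 else 12 := by
  decide +kernel

theorem card_common_neighbors {x y : HeisenbergThree} (h : x ≠ y) :
    Nat.card {z // graph.Adj x z ∧ graph.Adj y z} =
      if centreCoset x = centreCoset y then 9 else 12 := by
  rw [card_common_neighbors_eq_one, Nat.card_eq_fintype_card, card_common_neighbors_one]
  · simp only [centreCoset_eq_iff x y]
  · rwa [Ne, inv_mul_eq_one]

theorem isDDG_graph : IsDDG graph 27 18 9 12 9 3 := by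
  refine ⟨?_, rfl, card_neighbors, centreCoset, ?_, fun x y hne hc => ?_, fun x y hc => ?_⟩
  · rw [Nat.card_eq_fintype_card]; decide +kernel
  · simp only [Nat.card_eq_fintype_card]; decide +kernel
  · rw [card_common_neighbors hne, if_pos hc]
  · rw [card_common_neighbors fun h => hc (congrArg _ h), if_neg hc]

end HeisenbergThree

/-- There exists a divisible design Cayley graph with parameters
`(27, 18, 9, 12, 9, 3)`. -/
theorem exists_ddcg_27_18_9_12_9_3 :
    ∃ (V : Type) (Γ : SimpleGraph V),
        IsDDG Γ 27 18 9 12 9 3 ∧ IsCayleyGraph Γ := by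
  exact ⟨_, _, HeisenbergThree.isDDG_graph, HeisenbergThree.isCayleyGraph_graph⟩
end
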